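/- arXiv:0708.0381 — 6 statements merged into one kernel-verified Lean document; each statement's English description precedes it below -/
import Mathlib

section
/- Let p be a prime and let f : Z/pZ → [0,1] be a function that is not identically 0. Let λ_1, ..., λ_p be the Fourier coefficients of f arranged by decreasing absolute value, i.e. λ_i = f̂(a_i) where |f̂(a_1)| ≥ |f̂(a_2)| ≥ ... ≥ |f̂(a_p)|, and let θ = p^{-1} Σ_n f(n). Suppose that for some integer k with 1 ≤ k < (log p)/(log 4) and some real γ ≥ 0 we have |λ_{k+1}| ≤ γ |λ_k|. Then |{ n ∈ Z/pZ : (f*f)(n) > 0 }| ≥ p(1 − 2 θ p² γ² |λ_k|^{−2}). -/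
open Finset

/-- The Fourier transform of `f : ZMod p → ℝ`:
`f̂(a) = ∑ n, f n * e^(2πi a n / p)`, where `a n` is computed from the canonical
integer representatives (the value is well defined modulo `p`). -/
noncomputable def dft (p : ℕ) [NeZero p] (f : ZMod p → ℝ) (a : ZMod p) : ℂ :=
  ∑ n : ZMod p, (f n : ℂ) *
    Complex.exp (2 * Real.pi * Complex.I * ((a.val * n.val : ℕ) : ℂ) / p)

/-- A set `Λ` of residues with `4 ^ #Λ < p` has a difference with only one representation. -/
lemma exists_unique_difference (p : ℕ) [Fact p.Prime] (Λ : Finset (ZMod p)) (hΛ : Λ.Nonempty)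
    (hcard : 4 ^ #Λ < p) :
    ∃ u ∈ Λ, ∃ v ∈ Λ, ∀ x ∈ Λ, ∀ y ∈ Λ, x - y = u - v → x = u := by
  have hp : 0 < p := (Fact.out : p.Prime).pos
  have hbox : ∀ t : ZMod p, 4 * t.val / p < 4 := fun t => by
    rw [Nat.div_lt_iff_lt_mul hp]
    have := ZMod.val_lt t
    omega
  let box : ZMod p → (Λ → Fin 4) := fun t x => ⟨4 * (t * x : ZMod p).val / p, hbox _⟩
  obtain ⟨t, s, hts, hbe⟩ := Fintype.exists_ne_map_eq_of_card_lt box (by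
    simpa [ZMod.card] using hcard)
  let w : ZMod p → ℤ := fun x => ((t * x).val : ℤ) - ((s * x).val : ℤ)
  have hw : ∀ x, ((w x : ℤ) : ZMod p) = (t - s) * x := fun x => by
    simp [w, sub_mul]
  have hsmall : ∀ x ∈ Λ, |4 * w x| < p := fun x hx => by
    have h : 4 * (t * x).val / p = 4 * (s * x).val / p := by
      simpa [box] using congrFun hbe ⟨x, hx⟩
    have h1 := Nat.div_add_mod (4 * (t * x).val) p
    have h2 := Nat.div_add_mod (4 * (s * x).val) p
    have h3 := Nat.mod_lt (4 * (t * x).val) hp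
    have h4 := Nat.mod_lt (4 * (s * x).val) hp
    rw [h] at h1
    simp only [w]
    rw [abs_lt]
    constructor <;> omega
  obtain ⟨u, hu, hmax⟩ := Λ.exists_max_image w hΛ
  obtain ⟨v, hv, hmin⟩ := Λ.exists_min_image w hΛ
  refine ⟨u, hu, v, hv, fun x hx y hy hxy => ?_⟩
  have hdvd : (p : ℤ) ∣ w u - w v - (w x - w y) := by
    rw [← ZMod.intCast_zmod_eq_zero_iff_dvd]
    push_cast
    rw [hw, hw, hw, hw]
    linear_combination -(t - s) * hxy
  have hzero : w u - w v - (w x - w y) = 0 := by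
    have := hmax x hx
    have := hmin y hy
    have := abs_lt.1 (hsmall u hu)
    have := abs_lt.1 (hsmall v hv)
    have := abs_lt.1 (hsmall x hx)
    have := abs_lt.1 (hsmall y hy)
    refine Int.eq_zero_of_abs_lt_dvd hdvd ?_
    rw [abs_lt]
    constructor <;> omega
  have hwx : w x = w u := by
    have := hmax x hx
    have := hmin y hy
    omega
  have h := congrArg (Int.cast : ℤ → ZMod p) hwx
  rw [hw, hw] at h
  exact mul_left_cancel₀ (sub_ne_zero.2 hts) h

lemma sum_stdAddChar_mul (p : ℕ) [NeZero p] (c : ZMod p) :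
    ∑ n : ZMod p, ZMod.stdAddChar (n * c) = if c = 0 then (p : ℂ) else 0 := by
  simpa [ZMod.card] using
    AddChar.sum_mulShift c (ZMod.isPrimitive_stdAddChar p)

lemma dft_eq_sum_stdAddChar (p : ℕ) [NeZero p] (f : ZMod p → ℝ) (a : ZMod p) :
    dft p f a = ∑ n : ZMod p, (f n : ℂ) * ZMod.stdAddChar (a * n) := by
  refine Finset.sum_congr rfl fun n _ => ?_
  have h : a * n = (((a.val * n.val : ℕ) : ℤ) : ZMod p) := by simp
  rw [h, ZMod.stdAddChar_coe, Int.cast_natCast]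

lemma sum_norm_sq_sum_mul_stdAddChar (p : ℕ) [NeZero p] (g : ZMod p → ℂ) :
    ∑ n : ZMod p, ‖∑ a : ZMod p, g a * ZMod.stdAddChar (n * a)‖ ^ 2
      = p * ∑ a : ZMod p, ‖g a‖ ^ 2 := by
  have h : ∀ z : ℂ, ((‖z‖ ^ 2 : ℝ) : ℂ) = z * (starRingEnd ℂ) z := fun z => by
    rw [Complex.mul_conj, Complex.normSq_eq_norm_sq]
  apply Complex.ofReal_injective
  rw [Complex.ofReal_sum, Complex.ofReal_mul, Complex.ofReal_sum]
  simp_rw [h, map_sum, map_mul, Finset.sum_mul_sum, ← AddChar.map_neg_eq_conj]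
  calc _ = ∑ a, ∑ b, g a * (starRingEnd ℂ) (g b) *
        ∑ n : ZMod p, ZMod.stdAddChar (n * (a - b)) := by
        rw [Finset.sum_comm]
        refine Finset.sum_congr rfl fun a _ => ?_
        rw [Finset.sum_comm]
        refine Finset.sum_congr rfl fun b _ => ?_
        rw [Finset.mul_sum]
        refine Finset.sum_congr rfl fun n _ => ?_
        rw [mul_sub, sub_eq_add_neg, AddChar.map_add_eq_mul]
        ring
    _ = _ := by
        simp [sum_stdAddChar_mul, sub_eq_zero, Finset.mul_sum, mul_comm]

lemma sum_dft_mul_dft_mul_stdAddChar (p : ℕ) [NeZero p] (f : ZMod p → ℝ) (b n : ZMod p) :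
    ∑ a : ZMod p, dft p f a * dft p f (a - b) * ZMod.stdAddChar (-n * a)
      = p * ∑ m : ZMod p, ((f m * f (n - m) : ℝ) : ℂ) * ZMod.stdAddChar (-(b * (n - m))) := by
  simp_rw [dft_eq_sum_stdAddChar, Finset.sum_mul_sum, Finset.sum_mul]
  calc _ = ∑ m, ∑ l, (f m : ℂ) * f l * ZMod.stdAddChar (-(b * l)) *
        ∑ a : ZMod p, ZMod.stdAddChar (a * (l - (n - m))) := by
        rw [Finset.sum_comm]
        refine Finset.sum_congr rfl fun m _ => ?_
        rw [Finset.sum_comm]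
        refine Finset.sum_congr rfl fun l _ => ?_
        rw [Finset.mul_sum]
        refine Finset.sum_congr rfl fun a _ => ?_
        rw [show a * (l - (n - m)) = a * m + a * l + -n * a by ring,
          show (a - b) * l = a * l + -(b * l) by ring]
        simp_rw [AddChar.map_add_eq_mul]
        ring
    _ = _ := by
        simp [sum_stdAddChar_mul, sub_eq_zero, Finset.mul_sum, mul_comm, mul_assoc,
          mul_left_comm]

lemma sum_norm_sq_dft (p : ℕ) [NeZero p] (f : ZMod p → ℝ) :
    ∑ a : ZMod p, ‖dft p f a‖ ^ 2 = p * ∑ n : ZMod p, f n ^ 2 := by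
  simpa [dft_eq_sum_stdAddChar] using sum_norm_sq_sum_mul_stdAddChar p fun n => (f n : ℂ)

/-- If the Fourier coefficients of `f` have norm at least `L` on a small set `Λ` and at most `ε`
off it, then `f * f` has few zeros. -/
lemma card_convolution_eq_zero_mul_le (p : ℕ) [Fact p.Prime] (f : ZMod p → ℝ)
    (hf01 : ∀ n, f n ∈ Set.Icc (0 : ℝ) 1) (Λ : Finset (ZMod p)) (hΛ : Λ.Nonempty)
    (hcard : 4 ^ #Λ < p) (L ε : ℝ) (hL : 0 ≤ L) (hin : ∀ a ∈ Λ, L ≤ ‖dft p f a‖)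
    (hout : ∀ a ∉ Λ, ‖dft p f a‖ ≤ ε) :
    (#{n : ZMod p | ¬ 0 < ∑ m, f m * f (n - m)} : ℝ) * L ^ 4
      ≤ 2 * p ^ 2 * ε ^ 2 * ∑ n, f n := by
  obtain ⟨u, hu, v, hv, huniq⟩ := exists_unique_difference p Λ hΛ hcard
  set b := u - v with hb
  set F : ZMod p → ℂ := fun a => dft p f a * dft p f (a - b) with hF
  set g : ZMod p → ℂ := fun a => if a = u then 0 else F a with hg
  have hzero : ∀ n, (¬ 0 < ∑ m, f m * f (n - m)) →
      L ^ 4 ≤ ‖∑ a, g a * ZMod.stdAddChar (-n * a)‖ ^ 2 := by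
    intro n hn
    have hnn : ∀ m ∈ (Finset.univ : Finset (ZMod p)), 0 ≤ f m * f (n - m) :=
      fun m _ => mul_nonneg (hf01 m).1 (hf01 _).1
    have hprod := (Finset.sum_eq_zero_iff_of_nonneg hnn).1
      (le_antisymm (not_lt.1 hn) (Finset.sum_nonneg hnn))
    have htot : ∑ a, F a * ZMod.stdAddChar (-n * a) = 0 := by
      rw [hF, sum_dft_mul_dft_mul_stdAddChar, Finset.sum_eq_zero, mul_zero]
      intro m hm
      rw [hprod m hm, Complex.ofReal_zero, zero_mul]
    have hsplit : ∑ a, F a * ZMod.stdAddChar (-n * a)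
        = F u * ZMod.stdAddChar (-n * u) + ∑ a, g a * ZMod.stdAddChar (-n * a) := by
      rw [← Finset.add_sum_erase _ _ (Finset.mem_univ u),
        ← Finset.add_sum_erase _ (fun a => g a * _) (Finset.mem_univ u)]
      simp only [hg, if_true, zero_mul, zero_add]
      congr 1
      refine Finset.sum_congr rfl fun a ha => ?_
      rw [if_neg (Finset.ne_of_mem_erase ha)]
    have hnorm : ‖∑ a, g a * ZMod.stdAddChar (-n * a)‖ = ‖dft p f u‖ * ‖dft p f v‖ := by
      rw [← neg_eq_of_add_eq_zero_right (hsplit.symm.trans htot), norm_neg, norm_mul,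
        AddChar.norm_apply, mul_one, hF, norm_mul, hb, sub_sub_cancel]
    rw [hnorm]
    calc L ^ 4 = (L * L) ^ 2 := by ring
      _ ≤ _ := by gcongr; exacts [hin u hu, hin v hv]
  have hgle : ∀ a, ‖g a‖ ^ 2 ≤ ε ^ 2 * (‖dft p f a‖ ^ 2 + ‖dft p f (a - b)‖ ^ 2) := by
    intro a
    by_cases hau : a = u
    · simp only [hg, if_pos hau, norm_zero, zero_pow two_ne_zero]
      positivity
    · have hnot : a ∉ Λ ∨ a - b ∉ Λ := by
        by_contra! h
        exact hau (huniq a h.1 (a - b) h.2 (by ring))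
      simp only [hg, hF, if_neg hau, norm_mul, mul_pow]
      rcases hnot with h | h
      · have := pow_le_pow_left₀ (norm_nonneg _) (hout _ h) 2
        nlinarith [sq_nonneg ‖dft p f (a - b)‖, mul_nonneg (sq_nonneg ε) (sq_nonneg ‖dft p f a‖)]
      · have := pow_le_pow_left₀ (norm_nonneg _) (hout _ h) 2
        nlinarith [sq_nonneg ‖dft p f a‖, mul_nonneg (sq_nonneg ε) (sq_nonneg ‖dft p f (a - b)‖)]
  have hsum : ∑ a, ‖g a‖ ^ 2 ≤ ε ^ 2 * (2 * (p * ∑ n, f n ^ 2)) := by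
    refine (Finset.sum_le_sum fun a _ => hgle a).trans_eq ?_
    have hshift : ∑ a, ‖dft p f (a - b)‖ ^ 2 = ∑ a, ‖dft p f a‖ ^ 2 :=
      Equiv.sum_comp (Equiv.subRight b) fun a => ‖dft p f a‖ ^ 2
    rw [← Finset.mul_sum, Finset.sum_add_distrib, hshift, ← sum_norm_sq_dft]
    ring
  have hsq : ∑ n, f n ^ 2 ≤ ∑ n, f n :=
    Finset.sum_le_sum fun n _ => pow_le_of_le_one (hf01 n).1 (hf01 n).2 two_ne_zero
  calc _ = ∑ n : ZMod p with ¬ 0 < ∑ m, f m * f (n - m), L ^ 4 := by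
        rw [Finset.sum_const, nsmul_eq_mul]
    _ ≤ ∑ n : ZMod p with ¬ 0 < ∑ m, f m * f (n - m),
          ‖∑ a, g a * ZMod.stdAddChar (-n * a)‖ ^ 2 :=
        Finset.sum_le_sum fun n hn => hzero n (Finset.mem_filter.1 hn).2
    _ ≤ ∑ n : ZMod p, ‖∑ a, g a * ZMod.stdAddChar (-n * a)‖ ^ 2 :=
        Finset.sum_le_sum_of_subset_of_nonneg (Finset.filter_subset _ _)
          fun _ _ _ => by positivity
    _ = p * ∑ a, ‖g a‖ ^ 2 := by
        rw [← sum_norm_sq_sum_mul_stdAddChar]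
        exact Equiv.sum_comp (Equiv.neg (ZMod p))
          fun n => ‖∑ a, g a * ZMod.stdAddChar (n * a)‖ ^ 2
    _ ≤ p * (ε ^ 2 * (2 * (p * ∑ n, f n))) := by
        refine mul_le_mul_of_nonneg_left (hsum.trans ?_) (Nat.cast_nonneg p)
        gcongr
    _ = _ := by ring

/-- **Theorem 1 (main theorem).** If `f : ZMod p → [0,1]` is not identically zero, its
Fourier coefficients are arranged as `λ_i = f̂(a_i)` with
`|f̂(a_1)| ≥ ⋯ ≥ |f̂(a_p)|`, `θ = p⁻¹ ∑ f(n)`, and for some `1 ≤ k < log p / log 4`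
one has `|λ_{k+1}| ≤ γ |λ_k|`, then
`|{n : (f*f)(n) > 0}| ≥ p (1 - 2 θ p² γ² |λ_k|⁻²)`.
(Here `a ⟨k-1, _⟩ = a_k` and `a k = a_{k+1}` in 0-based indexing.) -/
theorem spectral_gap_sumset (p : ℕ) [Fact p.Prime] (f : ZMod p → ℝ)
    (hf01 : ∀ n, f n ∈ Set.Icc (0 : ℝ) 1) (hf0 : f ≠ 0)
    (a : Fin p → ZMod p) (ha : Function.Bijective a)
    (hmono : ∀ i j : Fin p, i ≤ j → ‖dft p f (a j)‖ ≤ ‖dft p f (a i)‖)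
    (θ : ℝ) (hθ : θ = (∑ n : ZMod p, f n) / p)
    (k : Fin p) (hk1 : 1 ≤ (k : ℕ))
    (hklt : ((k : ℕ) : ℝ) < Real.log p / Real.log 4)
    (γ : ℝ) (hγ : 0 ≤ γ)
    (hgap : ‖dft p f (a k)‖ ≤
      γ * ‖dft p f (a ⟨(k : ℕ) - 1, lt_of_le_of_lt (Nat.sub_le _ _) k.isLt⟩)‖) :
    (p : ℝ) * (1 - 2 * θ * (p : ℝ) ^ 2 * γ ^ 2 *
        (‖dft p f (a ⟨(k : ℕ) - 1, lt_of_le_of_lt (Nat.sub_le _ _) k.isLt⟩)‖ ^ 2)⁻¹)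
      ≤ ((Finset.univ.filter fun n : ZMod p =>
            0 < ∑ m : ZMod p, f m * f (n - m)).card : ℝ) := by
  set l : Fin p := ⟨(k : ℕ) - 1, lt_of_le_of_lt (Nat.sub_le _ _) k.isLt⟩ with hl
  have hp : 0 < p := (Fact.out : p.Prime).pos
  have hpR : (0 : ℝ) < p := Nat.cast_pos.2 hp
  have h4k : 4 ^ (k : ℕ) < p := by
    rw [lt_div_iff₀ (Real.log_pos (by norm_num)), ← Real.log_pow,
      Real.log_lt_log_iff (by positivity) hpR] at hklt
    exact_mod_cast hklt
  have hcompl : (#{n : ZMod p | 0 < ∑ m, f m * f (n - m)} : ℝ)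
      + (#{n : ZMod p | ¬ 0 < ∑ m, f m * f (n - m)} : ℝ) = p := by
    rw [← Nat.cast_add, Finset.card_filter_add_card_filter_not, Finset.card_univ, ZMod.card]
  have hsum : ∑ n, f n = p * θ := by
    rw [hθ]
    field_simp
  by_cases hzero : ‖dft p f (a l)‖ = 0
  · let Λ : Finset (ZMod p) := {x | dft p f x ≠ 0}
    have hΛ : Λ.Nonempty := by
      by_contra! h
      have h0 : ∀ x, dft p f x = 0 := fun x => by
        by_contra hx
        exact Finset.notMem_empty x (h ▸ Finset.mem_filter.2 ⟨Finset.mem_univ x, hx⟩)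
      have hpars := sum_norm_sq_dft p f
      simp only [h0, norm_zero, ne_eq, OfNat.ofNat_ne_zero, not_false_eq_true, zero_pow,
        Finset.sum_const_zero, zero_eq_mul, hpR.ne', false_or] at hpars
      refine hf0 (funext fun n => ?_)
      exact pow_eq_zero_iff two_ne_zero |>.1
        ((Finset.sum_eq_zero_iff_of_nonneg fun n _ => sq_nonneg (f n)).1 hpars n
          (Finset.mem_univ n))
    have hsub : Λ ⊆ (Finset.Iio k).image a := by
      intro x hx
      obtain ⟨i, rfl⟩ := ha.2 x
      refine Finset.mem_image_of_mem a (Finset.mem_Iio.2 (lt_of_not_ge fun hki => ?_))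
      have hli : l ≤ i := le_trans (Fin.le_def.2 (Nat.sub_le _ _)) hki
      exact (Finset.mem_filter.1 hx).2 (norm_le_zero_iff.1 ((hmono l i hli).trans_eq hzero))
    have hcard : 4 ^ #Λ < p := by
      refine lt_of_le_of_lt (Nat.pow_le_pow_right (by norm_num) ?_) h4k
      exact (Finset.card_le_card hsub).trans (Finset.card_image_le.trans_eq (Fin.card_Iio k))
    obtain ⟨y, hy, hmin⟩ := Λ.exists_min_image (fun x => ‖dft p f x‖) hΛ
    have hypos : 0 < ‖dft p f y‖ := norm_pos_iff.2 (Finset.mem_filter.1 hy).2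
    have key := card_convolution_eq_zero_mul_le p f hf01 Λ hΛ hcard ‖dft p f y‖ 0
      hypos.le hmin fun x hx => by
        simpa [Λ] using hx
    have hcard_zero : (#{n : ZMod p | ¬ 0 < ∑ m, f m * f (n - m)} : ℝ) ≤ 0 := by
      refine le_of_mul_le_mul_right (key.trans_eq ?_) (pow_pos hypos 4)
      ring
    rw [hzero]
    simp only [ne_eq, OfNat.ofNat_ne_zero, not_false_eq_true, zero_pow, inv_zero, mul_zero,
      sub_zero, mul_one]
    linarith
  · have hLpos : 0 < ‖dft p f (a l)‖ := lt_of_le_of_ne (norm_nonneg _) (Ne.symm hzero)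
    have hΛcard : #((Finset.Iio k).image a) = k := by
      rw [Finset.card_image_of_injective _ ha.1, Fin.card_Iio]
    have key := card_convolution_eq_zero_mul_le p f hf01 ((Finset.Iio k).image a)
      (Finset.card_pos.1 (by omega)) (by rwa [hΛcard]) ‖dft p f (a l)‖
      (γ * ‖dft p f (a l)‖) hLpos.le
      (fun x hx => by
        obtain ⟨i, hi, rfl⟩ := Finset.mem_image.1 hx
        have hik : (i : ℕ) < k := Fin.lt_def.1 (Finset.mem_Iio.1 hi)
        exact hmono i l (Fin.le_def.2 (Nat.le_sub_one_of_lt hik)))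
      (fun x hx => by
        obtain ⟨i, rfl⟩ := ha.2 x
        have hki : k ≤ i := le_of_not_gt fun h =>
          hx (Finset.mem_image_of_mem a (Finset.mem_Iio.2 h))
        exact (hmono k i hki).trans hgap)
    set L := ‖dft p f (a l)‖
    have hle : (#{n : ZMod p | ¬ 0 < ∑ m, f m * f (n - m)} : ℝ)
        ≤ p * (2 * θ * (p : ℝ) ^ 2 * γ ^ 2 * (L ^ 2)⁻¹) := by
      refine le_of_mul_le_mul_right (key.trans_eq ?_) (pow_pos hLpos 4)
      rw [hsum]
      field_simp
    linarith
end

section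
/- (Unique Differences Lemma) Let p be a prime and let B = {b_1, ..., b_t} ⊆ Z/pZ be a set with t elements. If t < (log p)/(log 4), then there exists d ∈ Z/pZ having a unique representation as a difference of two elements of B; that is, there is exactly one ordered pair (b, b') ∈ B × B with b − b' = d. -/
/-- Dirichlet's simultaneous approximation modulo `p`: if `4 ^ #B < p`, some nonzero dilation
moves every element of `B` strictly within `p / 4` of `0`. -/
theorem exists_dilation_lift_lt {p : ℕ} [NeZero p] (B : Finset (ZMod p))
    (h : 4 ^ B.card < p) :
    ∃ x : ZMod p, x ≠ 0 ∧ ∃ z : ZMod p → ℤ,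
      (∀ b, (z b : ZMod p) = x * b) ∧ ∀ b ∈ B, 4 * |z b| < p := by
  have hp : 0 < p := NeZero.pos p
  let f : ZMod p → (B → Fin 4) := fun m b =>
    ⟨4 * (m * b).val / p, Nat.div_lt_of_lt_mul (by
      have := ZMod.val_lt (m * (b : ZMod p))
      lia)⟩
  obtain ⟨m, n, hmn, hf⟩ := Fintype.exists_ne_map_eq_of_card_lt f (by simpa using h)
  refine ⟨m - n, sub_ne_zero.mpr hmn, fun b => ((m * b).val : ℤ) - (n * b).val, ?_, ?_⟩
  · intro b
    simp [sub_mul]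
  · intro b hb
    have hq : 4 * (m * b).val / p = 4 * (n * b).val / p :=
      congrArg Fin.val (congrFun hf ⟨b, hb⟩)
    have h₁ := Nat.div_add_mod (4 * (m * b).val) p
    have h₂ := Nat.div_add_mod (4 * (n * b).val) p
    have h₃ := Nat.mod_lt (4 * (m * b).val) hp
    have h₄ := Nat.mod_lt (4 * (n * b).val) hp
    rw [hq] at h₁
    generalize p * (4 * (n * b).val / p) = k at h₁ h₂
    rcases abs_cases (((m * b).val : ℤ) - (n * b).val) with ⟨h, _⟩ | ⟨h, _⟩ <;> dsimp only <;>
      rw [h] <;> lia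

/-- **Unique Differences Lemma.** If `B ⊆ ZMod p` (`p` prime) is a nonempty set of
`t` elements with `t < (log p)/(log 4)`, then there exists `d ∈ ZMod p` having a unique
representation as a difference of two elements of `B`; i.e. there is exactly one ordered
pair `(b, b') ∈ B × B` with `b - b' = d`. -/
theorem unique_differences (p : ℕ) (hp : p.Prime) (B : Finset (ZMod p))
    (hB : B.Nonempty) (ht : (B.card : ℝ) < Real.log p / Real.log 4) :
    ∃ d : ZMod p, ∃! bb : ZMod p × ZMod p, bb.1 ∈ B ∧ bb.2 ∈ B ∧ bb.1 - bb.2 = d := by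
  have : Fact p.Prime := ⟨hp⟩
  have hcard : 4 ^ B.card < p := by
    rw [lt_div_iff₀ (Real.log_pos (by norm_num)), ← Real.log_pow] at ht
    exact_mod_cast (Real.log_lt_log_iff (by positivity) (by exact_mod_cast hp.pos)).mp ht
  obtain ⟨x, hx, z, hz, hsmall⟩ := exists_dilation_lift_lt B hcard
  obtain ⟨u, hu, hmax⟩ := B.exists_max_image z hB
  obtain ⟨v, hv, hmin⟩ := B.exists_min_image z hB
  have hinj : ∀ a b, z a = z b → a = b := fun a b hab =>
    mul_left_cancel₀ hx (by rw [← hz, ← hz, hab])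
  refine ⟨u - v, (u, v), ⟨hu, hv, rfl⟩, ?_⟩
  rintro ⟨a, b⟩ ⟨ha, hb, hab⟩
  dsimp only at ha hb hab
  have hdvd : (p : ℤ) ∣ (z u - z v) - (z a - z b) := by
    rw [← ZMod.intCast_zmod_eq_zero_iff_dvd]
    push_cast
    simp only [hz]
    linear_combination -x * hab
  have hau := hmax a ha
  have hvb := hmin b hb
  have hlt : (z u - z v) - (z a - z b) < p := by
    have := hsmall u hu
    have := hsmall v hv
    have := hsmall a ha
    have := hsmall b hb
    have := le_abs_self (z u)
    have := neg_abs_le (z v)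
    have := neg_abs_le (z a)
    have := le_abs_self (z b)
    lia
  have hzero := Int.eq_zero_of_dvd_of_nonneg_of_lt (by lia) hlt hdvd
  exact Prod.ext (hinj a u (by lia)) (hinj b v (by lia))
end

section
/- Let p be a (sufficiently large) prime and let B_1, B_2 ⊆ Z/pZ with 10 ≤ |B_1| ≤ p/2 and 3 |B_2| log |B_1| > log p. Then there exists d ∈ B_1 − B_2 having at most 20 |B_2| (log |B_1|)² / log p representations as d = b − b' with b ∈ B_1, b' ∈ B_2. -/
open Pointwise

open Finset in
/-- Greedy selection: `j` well-chosen points leave at most a proportion `(1 - s / #M) ^ j` of the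
sets `T i` unhit. -/
theorem exists_greedy_hitting {ι α : Type*} [DecidableEq α] (I : Finset ι) (M : Finset α)
    (T : ι → Finset α) (s : ℝ) (hM : M.Nonempty) (hT : ∀ i ∈ I, T i ⊆ M)
    (hs : ∀ i ∈ I, s ≤ #(T i)) (hsM : s ≤ #M) (j : ℕ) :
    ∃ C ⊆ M, #C ≤ j ∧ (#{i ∈ I | Disjoint (T i) C} : ℝ) ≤ #I * (1 - s / #M) ^ j := by
  have hm : (0 : ℝ) < #M := by exact_mod_cast hM.card_pos
  induction j with
  | zero => exact ⟨∅, by simp, by simp, by simp⟩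
  | succ j ih =>
    obtain ⟨C, hCM, hCj, hC⟩ := ih
    set U := {i ∈ I | Disjoint (T i) C} with hU
    have hUI : ∀ i ∈ U, i ∈ I := fun i hi => (mem_filter.mp hi).1
    have hcount : ∑ a ∈ M, #{i ∈ U | a ∈ T i} = ∑ i ∈ U, #(T i) := by
      have h := sum_card_bipartiteAbove_eq_sum_card_bipartiteBelow
        (s := M) (t := U) (fun a i => a ∈ T i)
      simp only [bipartiteAbove, bipartiteBelow] at h
      rw [h]
      refine sum_congr rfl fun i hi => ?_
      rw [filter_mem_eq_inter, inter_eq_right.mpr (hT i (hUI i hi))]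
    obtain ⟨a, haM, ha⟩ : ∃ a ∈ M, #U * s / #M ≤ (#{i ∈ U | a ∈ T i} : ℝ) := by
      refine exists_le_of_sum_le hM ?_
      rw [sum_const, nsmul_eq_mul, mul_div_cancel₀ _ hm.ne', ← Nat.cast_sum, hcount,
        Nat.cast_sum, ← nsmul_eq_mul]
      exact card_nsmul_le_sum _ _ _ fun i hi => hs i (hUI i hi)
    refine ⟨insert a C, insert_subset haM hCM, (card_insert_le _ _).trans (by omega), ?_⟩
    have hunhit : {i ∈ I | Disjoint (T i) (insert a C)} = {i ∈ U | ¬ a ∈ T i} := by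
      ext i
      simp only [hU, mem_filter, disjoint_insert_right]
      tauto
    have hsplit : (#{i ∈ U | a ∈ T i} : ℝ) + #{i ∈ U | ¬ a ∈ T i} = #U := by
      exact_mod_cast card_filter_add_card_filter_not (s := U) (fun i => a ∈ T i)
    have hfac : 0 ≤ 1 - s / #M := by
      rw [sub_nonneg, div_le_one hm]
      exact hsM
    rw [hunhit, pow_succ, ← mul_assoc]
    calc (#{i ∈ U | ¬ a ∈ T i} : ℝ) ≤ #U * (1 - s / #M) := by
          rw [mul_sub, mul_one, ← mul_div_assoc]; linarith
      _ ≤ _ := by gcongr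

open Finset in
/-- A family of subsets of `M` of size at least `s`, in which every point has degree at most `n`,
has a hitting set of size at most `#M / s * (log n + 2)`. -/
theorem exists_small_hitting {ι α : Type*} [DecidableEq α] (I : Finset ι) (M : Finset α)
    (T : ι → Finset α) (s n : ℝ) (hs0 : 0 < s) (hn : 1 ≤ n) (hT : ∀ i ∈ I, T i ⊆ M)
    (hs : ∀ i ∈ I, s ≤ #(T i)) (hdeg : ∀ a ∈ M, (#{i ∈ I | a ∈ T i} : ℝ) ≤ n) :
    ∃ C ⊆ M, (∀ i ∈ I, ∃ a ∈ C, a ∈ T i) ∧ (#C : ℝ) ≤ #M / s * (Real.log n + 2) := by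
  have hlog : 0 ≤ Real.log n := Real.log_nonneg hn
  rcases I.eq_empty_or_nonempty with rfl | ⟨i₀, hi₀⟩
  · exact ⟨∅, by simp, by simp, by simp only [card_empty, Nat.cast_zero]; positivity⟩
  have hsM : s ≤ #M := (hs i₀ hi₀).trans (by exact_mod_cast card_le_card (hT i₀ hi₀))
  have hm : (0 : ℝ) < #M := hs0.trans_le hsM
  have hM : M.Nonempty := card_pos.mp (by exact_mod_cast hm)
  set j := ⌈#M / s * Real.log n⌉₊ with hj
  obtain ⟨C, hCM, hCj, hC⟩ := exists_greedy_hitting I M T s hM hT hs hsM j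
  set U := {i ∈ I | Disjoint (T i) C} with hU
  have hI : (#I : ℝ) * s ≤ #M * n := by
    have h := sum_card_bipartiteAbove_eq_sum_card_bipartiteBelow
      (s := M) (t := I) (fun a i => a ∈ T i)
    simp only [bipartiteAbove, bipartiteBelow] at h
    have h1 : (#I : ℝ) * s ≤ ((∑ i ∈ I, #{a ∈ M | a ∈ T i} : ℕ) : ℝ) := by
      rw [Nat.cast_sum, ← nsmul_eq_mul]
      refine card_nsmul_le_sum _ _ _ fun i hi => ?_
      rw [filter_mem_eq_inter, inter_eq_right.mpr (hT i hi)]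
      exact hs i hi
    refine h1.trans ?_
    rw [← h, Nat.cast_sum, ← nsmul_eq_mul]
    exact sum_le_card_nsmul _ _ _ hdeg
  have hpow : (1 - s / #M) ^ j ≤ n⁻¹ := by
    have hfac : 0 ≤ 1 - s / #M := by
      rw [sub_nonneg, div_le_one hm]
      exact hsM
    calc (1 - s / #M) ^ j ≤ Real.exp (-(s / #M)) ^ j := by
          gcongr
          exact Real.one_sub_le_exp_neg _
      _ = Real.exp (-(s / #M * j)) := by rw [← Real.exp_nat_mul]; ring_nf
      _ ≤ Real.exp (-Real.log n) := by
          gcongr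
          calc Real.log n = s / #M * (#M / s * Real.log n) := by field_simp
            _ ≤ s / #M * j := by gcongr; exact Nat.le_ceil _
      _ = n⁻¹ := by rw [Real.exp_neg, Real.exp_log (by linarith)]
  have hUcard : (#U : ℝ) ≤ #M / s := by
    calc (#U : ℝ) ≤ #I * n⁻¹ := hC.trans (by gcongr)
      _ ≤ #M / s := by
          rw [← div_eq_mul_inv, div_le_div_iff₀ (by linarith) hs0]
          exact hI
  have hne : ∀ i ∈ I, (T i).Nonempty := fun i hi =>
    card_pos.mp (by exact_mod_cast hs0.trans_le (hs i hi))
  have : Nonempty α := ⟨hM.choose⟩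
  choose! g hg using hne
  refine ⟨C ∪ U.image g, union_subset hCM ?_, fun i hi => ?_, ?_⟩
  · intro a ha
    obtain ⟨i, hi, rfl⟩ := mem_image.mp ha
    have hi' := (mem_filter.mp hi).1
    exact hT i hi' (hg i hi')
  · by_cases hd : Disjoint (T i) C
    · exact ⟨g i, mem_union_right _ (mem_image_of_mem g (mem_filter.mpr ⟨hi, hd⟩)), hg i hi⟩
    · obtain ⟨a, ha, haC⟩ := not_disjoint_iff.mp hd
      exact ⟨a, mem_union_left _ haC, ha⟩
  · have h1 : (#(C ∪ U.image g) : ℝ) ≤ j + #U := by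
      exact_mod_cast (card_union_le _ _).trans (add_le_add hCj card_image_le)
    have h2 : (j : ℝ) < #M / s * Real.log n + 1 := Nat.ceil_lt_add_one (by positivity)
    have h3 : 1 ≤ #M / s := (one_le_div hs0).mpr hsM
    linarith

open Finset in
/-- Simultaneous Diophantine approximation modulo `p`: a set `C` with `Q ^ #C < p` has a nonzero
dilate contained in `(-p / Q, p / Q)`. -/
theorem ZMod.exists_small_dilate (p : ℕ) [Fact p.Prime] (C : Finset (ZMod p)) (Q : ℕ)
    (hQ : 0 < Q) (hC : Q ^ #C < p) :
    ∃ (l : ZMod p) (z : ZMod p → ℤ), l ≠ 0 ∧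
      ∀ c ∈ C, (z c : ZMod p) = l * c ∧ |z c| * Q < p := by
  have hp : 0 < p := (Fact.out : p.Prime).pos
  let box : ZMod p → (C → Fin Q) := fun l c =>
    ⟨(l * c).val * Q / p, by
      rw [Nat.div_lt_iff_lt_mul hp, mul_comm Q]
      exact Nat.mul_lt_mul_of_pos_right (ZMod.val_lt _) hQ⟩
  obtain ⟨x, y, hxy, hbox⟩ := Fintype.exists_ne_map_eq_of_card_lt box
    (by simpa [ZMod.card] using hC)
  refine ⟨x - y, fun c => (x * c).val - (y * c).val, sub_ne_zero.mpr hxy, fun c hc => ⟨?_, ?_⟩⟩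
  · simp [sub_mul]
  · have h : (x * c).val * Q / p = (y * c).val * Q / p := by
      simpa [box] using congrFun hbox ⟨c, hc⟩
    have hx := Nat.div_add_mod ((x * c).val * Q) p
    have hy := Nat.div_add_mod ((y * c).val * Q) p
    have hx0 := Nat.zero_le ((x * c).val * Q % p)
    have hy0 := Nat.zero_le ((y * c).val * Q % p)
    have hx' := Nat.mod_lt ((x * c).val * Q) hp
    have hy' := Nat.mod_lt ((y * c).val * Q) hp
    rw [h] at hx
    rw [← Nat.abs_cast Q, ← abs_mul, sub_mul, abs_lt]
    zify at hx hy hx0 hy0 hx' hy'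
    constructor <;> linarith

open Finset in
/-- A nonempty set `B` with `#B * K < p` has an element preceded by a gap of length `K`. -/
theorem ZMod.exists_mem_after_gap (p : ℕ) [NeZero p] (B : Finset (ZMod p)) (hB : B.Nonempty)
    (K : ℕ) (hK : #B * K < p) :
    ∃ b ∈ B, ∀ j : ℕ, 1 ≤ j → j ≤ K → b - j ∉ B := by
  obtain ⟨x, hx⟩ : ∃ x, x ∉ (B ×ˢ Icc 1 K).image fun q : ZMod p × ℕ => q.1 + q.2 := by
    by_contra! h
    have h1 : #(univ : Finset (ZMod p)) ≤ #B * K :=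
      calc _ ≤ _ := card_le_card fun x _ => h x
        _ ≤ #(B ×ˢ Icc 1 K) := card_image_le
        _ = #B * K := by simp
    rw [card_univ, ZMod.card] at h1
    omega
  have hex : ∃ i : ℕ, x + i ∈ B := by
    obtain ⟨b, hb⟩ := hB
    exact ⟨(b - x).val, by simpa using hb⟩
  classical
  refine ⟨x + Nat.find hex, Nat.find_spec hex, fun j hj1 hjK hmem => ?_⟩
  rcases le_or_gt j (Nat.find hex) with hle | hlt
  · refine Nat.find_min hex (m := Nat.find hex - j) (by omega) ?_
    rwa [Nat.cast_sub hle, ← add_sub_assoc]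
  · refine hx (mem_image.mpr ⟨(x + Nat.find hex - j, j - Nat.find hex), ?_, ?_⟩)
    · simp only [mem_product, mem_Icc]
      exact ⟨hmem, by omega, by omega⟩
    · simp only [Nat.cast_sub hlt.le]
      ring

open Finset in
/-- If `(2 * #B) ^ #C < p`, some difference in `B - C` is represented only once. -/
theorem ZMod.exists_unique_difference (p : ℕ) [Fact p.Prime] (B C : Finset (ZMod p))
    (hB : B.Nonempty) (hCne : C.Nonempty) (hC : (2 * #B) ^ #C < p) :
    ∃ b ∈ B, ∃ c ∈ C, ∀ c' ∈ C, b - c + c' ∈ B → c' = c := by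
  have hBpos := hB.card_pos
  obtain ⟨l, z, hl, hz⟩ := ZMod.exists_small_dilate p C (2 * #B) (by omega) hC
  obtain ⟨c, hc, hmax⟩ := C.exists_max_image z hCne
  obtain ⟨e, he, hmin⟩ := C.exists_min_image z hCne
  have hinj : Function.Injective (l * ·) := mul_right_injective₀ hl
  obtain ⟨b', hb', hgap⟩ := ZMod.exists_mem_after_gap p (B.image (l * ·)) (hB.image _)
    (z c - z e).toNat (by
      rw [card_image_of_injective _ hinj]
      zify
      rw [Int.toNat_of_nonneg (by linarith [hmin c hc])]
      have h1 := (hz c hc).2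
      have h2 := (hz e he).2
      have h3 := le_abs_self (z c)
      have h4 := neg_abs_le (z e)
      push_cast at h1 h2
      nlinarith)
  obtain ⟨b, hb, rfl⟩ := mem_image.mp hb'
  refine ⟨b, hb, c, hc, fun c' hc' hmem => ?_⟩
  have hle := hmax c' hc'
  have hge := hmin c' hc'
  have hcast : ((z c - z c').toNat : ZMod p) = l * c - l * c' := by
    rw [← (hz c hc).1, ← (hz c' hc').1, ← Int.cast_sub, ← Int.cast_natCast,
      Int.toNat_of_nonneg (by linarith)]
  rcases hle.eq_or_lt with heq | hlt
  · refine hinj ?_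
    change l * c' = l * c
    rw [← (hz c hc).1, ← (hz c' hc').1, heq]
  · refine absurd ?_ (hgap (z c - z c').toNat (by omega) (by omega))
    rw [hcast]
    exact mem_image.mpr ⟨_, hmem, by ring⟩

open Finset in
/-- The representations of `d` as a difference correspond to their second coordinates. -/
theorem card_filter_sub_eq {G : Type*} [AddCommGroup G] [DecidableEq G] (B₁ B₂ : Finset G)
    (d : G) : #{bb ∈ B₁ ×ˢ B₂ | bb.1 - bb.2 = d} = #{c ∈ B₂ | d + c ∈ B₁} := by
  refine card_nbij' (fun bb => bb.2) (fun c => (d + c, c)) ?_ ?_ ?_ ?_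
  · rintro ⟨b, c⟩ h
    simp only [coe_filter, mem_product, Set.mem_ofPred_eq] at h ⊢
    obtain ⟨⟨hb, hc⟩, rfl⟩ := h
    simpa using ⟨hc, hb⟩
  · intro c h
    simp only [coe_filter, mem_product, Set.mem_ofPred_eq] at h ⊢
    simpa using h.symm
  · rintro ⟨b, c⟩ h
    simp only [coe_filter, mem_product, Set.mem_ofPred_eq] at h
    simp [← h.2]
  · intro c _
    rfl

open Finset in
/-- If every element of `B₁ - B₂` has more than `s + 1` representations, a small subset of `B₂`
still represents each of them at least twice. -/
theorem exists_small_double_hitting {G : Type*} [AddCommGroup G] [DecidableEq G]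
    (B₁ B₂ : Finset G) (hB₁ : B₁.Nonempty) (s : ℝ) (hs0 : 0 < s)
    (hs : ∀ d ∈ B₁ - B₂, s + 1 ≤ #{c ∈ B₂ | d + c ∈ B₁}) :
    ∃ C ⊆ B₂, (∀ d ∈ B₁ - B₂, ∃ a ∈ C, ∃ a' ∈ C, a ≠ a' ∧ d + a ∈ B₁ ∧ d + a' ∈ B₁) ∧
      (#C : ℝ) ≤ 2 * (#B₂ / s * (Real.log #B₁ + 2)) := by
  have hn : (1 : ℝ) ≤ #B₁ := by exact_mod_cast hB₁.card_pos
  have hdeg : ∀ a : G, (#{d ∈ B₁ - B₂ | d + a ∈ B₁} : ℝ) ≤ #B₁ := fun a => by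
    exact_mod_cast card_le_card_of_injOn (· + a) (fun d hd => (mem_filter.mp hd).2)
      (add_left_injective a).injOn
  obtain ⟨C, hC, hhit, hCcard⟩ := exists_small_hitting (B₁ - B₂) B₂
    (fun d => {c ∈ B₂ | d + c ∈ B₁}) s #B₁ hs0 hn (fun _ _ => filter_subset _ _)
    (fun d hd => by linarith [hs d hd]) fun a ha => by simpa [ha] using hdeg a
  choose! f hfC hf using hhit
  obtain ⟨C', hC', hhit', hCcard'⟩ := exists_small_hitting (B₁ - B₂) B₂
    (fun d => {c ∈ B₂ | d + c ∈ B₁}.erase (f d)) s #B₁ hs0 hn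
    (fun _ _ => (erase_subset _ _).trans (filter_subset _ _))
    (fun d hd => by
      have h : (#{c ∈ B₂ | d + c ∈ B₁} : ℝ) ≤ #({c ∈ B₂ | d + c ∈ B₁}.erase (f d)) + 1 := by
        exact_mod_cast (card_erase_add_one (hf d hd)).ge
      linarith [hs d hd])
    (fun a _ => le_trans (by
      refine Nat.cast_le.mpr (card_le_card fun d hd => ?_)
      simp only [mem_filter, mem_erase] at hd ⊢
      exact ⟨hd.1, hd.2.2.2⟩) (hdeg a))
  refine ⟨C ∪ C', union_subset hC hC', fun d hd => ?_, ?_⟩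
  · obtain ⟨a, haC', ha⟩ := hhit' d hd
    simp only [mem_filter, mem_erase] at ha
    exact ⟨a, mem_union_right _ haC', f d, mem_union_left _ (hfC d hd), ha.1, ha.2.2,
      (mem_filter.mp (hf d hd)).2⟩
  · have h : (#(C ∪ C') : ℝ) ≤ #C + #C' := by exact_mod_cast card_union_le _ _
    linarith

/-- **Lemma (few representations).** For all sufficiently large primes `p`: if
`B₁, B₂ ⊆ ZMod p` with `10 ≤ |B₁| ≤ p/2` and `3 |B₂| log |B₁| > log p`, then there
exists `d ∈ B₁ - B₂` having at most `20 |B₂| (log |B₁|)² / log p` representations as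
`d = b - b'` with `b ∈ B₁`, `b' ∈ B₂`. -/
theorem few_representations : ∃ N : ℕ, ∀ p : ℕ, p.Prime → N ≤ p →
    ∀ B₁ B₂ : Finset (ZMod p),
      10 ≤ B₁.card → (B₁.card : ℝ) ≤ (p : ℝ) / 2 →
      Real.log p < 3 * B₂.card * Real.log B₁.card →
      ∃ d ∈ B₁ - B₂,
        (((B₁ ×ˢ B₂).filter fun bb : ZMod p × ZMod p => bb.1 - bb.2 = d).card : ℝ)
          ≤ 20 * B₂.card * (Real.log B₁.card) ^ 2 / Real.log p := by
  refine ⟨0, fun p hp _ B₁ B₂ hn _ hlog => ?_⟩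
  have : Fact p.Prime := ⟨hp⟩
  have hB₁ : B₁.Nonempty := Finset.card_pos.mp (by omega)
  have hn' : (10 : ℝ) ≤ B₁.card := by exact_mod_cast hn
  have hp1 : (1 : ℝ) < p := by exact_mod_cast hp.one_lt
  have hP : 0 < Real.log p := Real.log_pos hp1
  have hx : (9 / 4 : ℝ) ≤ Real.log B₁.card := by
    have h2 : (9 / 4 : ℝ) ≤ Real.log 10 := by
      have h8 : Real.log 10 = 3 * Real.log 2 + Real.log (5 / 4) := by
        rw [show (10 : ℝ) = 2 ^ 3 * (5 / 4) by norm_num,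
          Real.log_mul (by norm_num) (by norm_num), Real.log_pow]
        norm_num
      have h54 := Real.one_sub_inv_le_log_of_pos (show (0 : ℝ) < 5 / 4 by norm_num)
      norm_num at h54
      linarith [Real.log_two_gt_d9]
    exact h2.trans (Real.log_le_log (by norm_num) hn')
  set x := Real.log B₁.card with hx_def
  have hm : (0 : ℝ) < B₂.card := by
    by_contra! h
    nlinarith
  have hB₂ : B₂.Nonempty := Finset.card_pos.mp (by exact_mod_cast hm)
  by_contra! hcon
  set t := 20 * B₂.card * x ^ 2 / Real.log p with ht
  have ht15 : 15 ≤ t := by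
    rw [ht, le_div_iff₀ hP]
    nlinarith
  obtain ⟨C, hCB, hC, hCcard⟩ := exists_small_double_hitting B₁ B₂ hB₁ (t - 1) (by linarith)
    fun d hd => by
      rw [← card_filter_sub_eq]
      linarith [hcon d hd]
  have hCne : C.Nonempty := by
    obtain ⟨d, hd⟩ := hB₁.sub hB₂
    obtain ⟨a, ha, -⟩ := hC d hd
    exact ⟨a, ha⟩
  have hratio : B₂.card / (t - 1) ≤ 3 / 40 * (Real.log p / x ^ 2) := by
    have htP : t * Real.log p = 20 * B₂.card * x ^ 2 := by rw [ht]; field_simp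
    rw [← mul_div_assoc, div_le_div_iff₀ (by linarith) (by positivity)]
    nlinarith
  have hsmall : (C.card : ℝ) * x ≤ 3 / 10 * Real.log p := by
    have h1 : (C.card : ℝ) ≤ 2 * (3 / 40 * (Real.log p / x ^ 2) * (2 * x)) :=
      hCcard.trans (by gcongr; linarith)
    calc (C.card : ℝ) * x ≤ 2 * (3 / 40 * (Real.log p / x ^ 2) * (2 * x)) * x := by gcongr
      _ = 3 / 10 * Real.log p := by field_simp; norm_num
  have hpow : (2 * B₁.card) ^ C.card < p := by
    have hlt : Real.log ((2 * B₁.card : ℝ) ^ C.card) < Real.log p := by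
      rw [Real.log_pow, Real.log_mul (by norm_num) (by positivity), ← hx_def]
      have : (C.card : ℝ) * (Real.log 2 + x) ≤ C.card * (2 * x) := by
        gcongr
        linarith [Real.log_two_lt_d9]
      linarith
    exact_mod_cast (Real.log_lt_log_iff (by positivity) (by positivity)).mp hlt
  obtain ⟨b, hb, c, hc, huniq⟩ := ZMod.exists_unique_difference p B₁ C hB₁ hCne hpow
  obtain ⟨a, ha, a', ha', hne, h, h'⟩ := hC (b - c) (Finset.sub_mem_sub hb (hCB hc))
  exact hne ((huniq a ha h).trans (huniq a' ha' h').symm)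
end

section
/- Let p be a prime and let B_1, B_2 ⊆ Z/pZ be nonempty with 1 ≤ |B_1| ≤ p/2 and 3 |B_2| log |B_1| < log p. Then there exists d ∈ B_1 − B_2 having a unique representation as d = b_1 − b_2 with b_1 ∈ B_1, b_2 ∈ B_2; that is, exactly one ordered pair (b_1, b_2) ∈ B_1 × B_2 satisfies b_1 − b_2 = d. -/
/-- Simultaneous Dirichlet approximation in `ZMod p`: a small set has a nontrivial dilate all of
whose elements have small integer representatives. -/
theorem ZMod.exists_dilate_small {p : ℕ} [NeZero p] (S : Finset (ZMod p)) {Q : ℕ} (hQ : 0 < Q)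
    (h : Q ^ S.card < p) :
    ∃ t : ZMod p, t ≠ 0 ∧ ∃ r : ZMod p → ℤ,
      ∀ b ∈ S, (r b : ZMod p) = t * b ∧ |r b| * Q < p := by
  have hp : 0 < p := NeZero.pos p
  let f : ZMod p → S → Fin Q := fun t b =>
    ⟨(t * b).val * Q / p, by
      rw [Nat.div_lt_iff_lt_mul hp, mul_comm Q]
      exact Nat.mul_lt_mul_of_pos_right (ZMod.val_lt _) hQ⟩
  obtain ⟨u, v, huv, hf⟩ := Fintype.exists_ne_map_eq_of_card_lt f (by simpa [ZMod.card] using h)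
  refine ⟨u - v, sub_ne_zero.mpr huv, fun b => ((u * b).val : ℤ) - (v * b).val, fun b hb => ?_⟩
  constructor
  · simp [sub_mul]
  · have hfb : (u * b).val * Q / p = (v * b).val * Q / p :=
      congrArg Fin.val (congrFun hf ⟨b, hb⟩)
    have hu := Nat.div_add_mod ((u * b).val * Q) p
    have hv := Nat.div_add_mod ((v * b).val * Q) p
    have hu' := Nat.mod_lt ((u * b).val * Q) hp
    have hv' := Nat.mod_lt ((v * b).val * Q) hp
    rw [hfb] at hu
    rw [← Nat.abs_cast Q, ← abs_mul, sub_mul, abs_lt]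
    zify at hu hv hu' hv'
    have hu0 : (0 : ℤ) ≤ ((u * b).val * Q : ℤ) % p := Int.emod_nonneg _ (by positivity)
    have hv0 : (0 : ℤ) ≤ ((v * b).val * Q : ℤ) % p := Int.emod_nonneg _ (by positivity)
    constructor <;> linarith

/-- A set of residues with `A.card * (L + 1) < p` has an element preceded by a gap of length `L`. -/
theorem ZMod.exists_mem_forall_sub_notMem {p : ℕ} [NeZero p] {A : Finset (ZMod p)}
    (hA : A.Nonempty) {L : ℕ} (h : A.card * (L + 1) < p) :
    ∃ x ∈ A, ∀ j : ℕ, 1 ≤ j → j ≤ L → x - j ∉ A := by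
  classical
  obtain ⟨y, hy⟩ : ∃ y, y ∉ (A ×ˢ Finset.range (L + 1)).image fun a => a.1 + (a.2 : ZMod p) := by
    by_contra! hall
    have hcard := Finset.card_image_le (s := A ×ˢ Finset.range (L + 1))
      (f := fun a => a.1 + (a.2 : ZMod p))
    rw [Finset.eq_univ_of_forall hall, Finset.card_univ, ZMod.card, Finset.card_product,
      Finset.card_range] at hcard
    omega
  have hex : ∃ k : ℕ, y + k ∈ A := by
    obtain ⟨a, ha⟩ := hA
    exact ⟨(a - y).val, by simpa using ha⟩
  refine ⟨_, Nat.find_spec hex, fun j hj hjL hmem => ?_⟩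
  rcases le_or_gt j (Nat.find hex) with hjk | hjk
  · refine Nat.find_min hex (m := Nat.find hex - j) (by omega) ?_
    rwa [Nat.cast_sub hjk, ← add_sub_assoc]
  · refine hy (Finset.mem_image.mpr ⟨(_, j - Nat.find hex), Finset.mem_product.mpr
      ⟨hmem, Finset.mem_range.mpr (by dsimp only; omega)⟩, ?_⟩)
    simp only [Nat.cast_sub hjk.le]
    ring

/-- **Lemma (unique representation between two sets).** If `B₁, B₂ ⊆ ZMod p` (`p` prime)
are nonempty, with `1 ≤ |B₁| ≤ p/2` and `3 |B₂| log |B₁| < log p`, then there exists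
`d ∈ B₁ - B₂` having a unique representation as `d = b₁ - b₂` with `b₁ ∈ B₁`,
`b₂ ∈ B₂`; i.e. exactly one ordered pair `(b₁, b₂) ∈ B₁ × B₂` satisfies `b₁ - b₂ = d`. -/
theorem unique_difference_two_sets (p : ℕ) (hp : p.Prime) (B₁ B₂ : Finset (ZMod p))
    (h₁ : B₁.Nonempty) (h₂ : B₂.Nonempty)
    (hcard : 1 ≤ B₁.card) (hhalf : (B₁.card : ℝ) ≤ (p : ℝ) / 2)
    (hlog : 3 * B₂.card * Real.log B₁.card < Real.log p) :
    ∃ d : ZMod p, ∃! bb : ZMod p × ZMod p, bb.1 ∈ B₁ ∧ bb.2 ∈ B₂ ∧ bb.1 - bb.2 = d := by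
  classical
  have : Fact p.Prime := ⟨hp⟩
  rcases hcard.eq_or_lt with hone | htwo
  · obtain ⟨a, rfl⟩ := Finset.card_eq_one.mp hone.symm
    obtain ⟨b, hb⟩ := h₂
    refine ⟨a - b, (a, b), ⟨Finset.mem_singleton_self a, hb, rfl⟩, ?_⟩
    rintro ⟨c₁, c₂⟩ ⟨hc₁, -, hc⟩
    obtain rfl := Finset.mem_singleton.mp hc₁
    simpa using hc
  have hpow : (B₁.card ^ 3) ^ B₂.card < p := by
    rw [← pow_mul]
    have hlt : Real.log ((B₁.card : ℝ) ^ (3 * B₂.card)) < Real.log p := by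
      rw [Real.log_pow]
      exact_mod_cast hlog
    exact_mod_cast (Real.log_lt_log_iff (by positivity) (mod_cast hp.pos)).mp hlt
  obtain ⟨t, ht, r, hr⟩ := ZMod.exists_dilate_small B₂ (pow_pos hcard 3) hpow
  set R := (p - 1) / B₁.card ^ 3
  have hrR : ∀ b ∈ B₂, |r b| ≤ R := fun b hb => by
    have hb' := (hr b hb).2
    rw [Int.abs_eq_natAbs] at hb' ⊢
    norm_cast at hb' ⊢
    exact (Nat.le_div_iff_mul_le (pow_pos hcard 3)).mpr (by omega)
  have hinj : Function.Injective (t * ·) := mul_right_injective₀ ht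
  have hgap : (B₁.image (t * ·)).card * (2 * R + 1) < p := by
    rw [Finset.card_image_of_injective _ hinj]
    have hR : R * B₁.card ^ 3 ≤ p - 1 := Nat.div_mul_le_self _ _
    have hhalf' : 2 * B₁.card ≤ p := by
      have : 2 * (B₁.card : ℝ) ≤ p := by linarith
      exact_mod_cast this
    have hcube : 4 * B₁.card ≤ B₁.card ^ 3 := by
      nlinarith [Nat.mul_le_mul htwo htwo]
    have := Nat.mul_le_mul_left R hcube
    have := hp.pos
    have : R * B₁.card ^ 3 < p := by omega
    nlinarith
  obtain ⟨x, hx, hxgap⟩ := ZMod.exists_mem_forall_sub_notMem (h₁.image _) hgap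
  obtain ⟨b₁, hb₁, rfl⟩ := Finset.mem_image.mp hx
  obtain ⟨b₂, hb₂, hmax⟩ := Finset.exists_max_image B₂ r h₂
  refine ⟨b₁ - b₂, (b₁, b₂), ⟨hb₁, hb₂, rfl⟩, ?_⟩
  rintro ⟨c₁, c₂⟩ ⟨hc₁, hc₂, hc⟩
  dsimp only at hc₁ hc₂ hc
  obtain ⟨j, hj⟩ := Int.eq_ofNat_of_zero_le (sub_nonneg.mpr (hmax c₂ hc₂))
  have hjt : t * c₁ = t * b₁ - j := by
    have hj' := congrArg (Int.cast : ℤ → ZMod p) hj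
    push_cast at hj'
    rw [(hr b₂ hb₂).1, (hr c₂ hc₂).1] at hj'
    linear_combination t * hc - hj'
  have hj0 : j = 0 := by
    by_contra hne
    refine hxgap j (by omega) ?_ (hjt ▸ Finset.mem_image_of_mem _ hc₁)
    have h1 := abs_le.mp (hrR b₂ hb₂)
    have h2 := abs_le.mp (hrR c₂ hc₂)
    omega
  have hcb : c₁ = b₁ := hinj (by simpa [hj0] using hjt)
  subst hcb
  simpa using hc
end

section
/- Let p be a prime and let B = {b_1, ..., b_t} ⊆ Z/pZ be a set of t elements with p > 4^t. Then there exists a nonzero m ∈ Z/pZ such that for every i, the integer representative c_i of m·b_i with |c_i| < p/2 in fact satisfies |c_i| < p/4; that is, every element of the dilate m·B has its representative in (−p/2, p/2) lying in (−p/4, p/4). -/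
/-- If `u` and `v` have their residues in the same quarter of `[0, p)`, then `u - v` has its
representative in `(-p/4, p/4)`. -/
lemma four_mul_abs_valMinAbs_sub_lt {p : ℕ} [NeZero p] {u v : ZMod p}
    (h : 4 * u.val / p = 4 * v.val / p) : 4 * |(u - v).valMinAbs| < (p : ℤ) := by
  have hu := Nat.div_add_mod (4 * u.val) p
  have hv := Nat.div_add_mod (4 * v.val) p
  have hu' := Nat.mod_lt (4 * u.val) (NeZero.pos p)
  have hv' := Nat.mod_lt (4 * v.val) (NeZero.pos p)
  rw [h] at hu
  have hd : 4 * |(u.val : ℤ) - v.val| < p := by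
    rcases abs_cases ((u.val : ℤ) - v.val) with h' | h' <;> lia
  have hrep : (u - v).valMinAbs = (u.val : ℤ) - v.val := by
    refine (ZMod.valMinAbs_spec _ _).2 ⟨by simp, ?_, ?_⟩ <;> lia
  rwa [hrep]


/-- If `B ⊆ ZMod p` (`p` prime) has `t` elements and `p > 4^t`, then there is a nonzero
dilation `m ∈ ZMod p` such that for every `b ∈ B`, the representative of `m·b` in
`(-p/2, p/2]` (given by `ZMod.valMinAbs`) actually lies in `(-p/4, p/4)`. -/
theorem dilate_into_middle_half (p t : ℕ) [Fact p.Prime] (B : Finset (ZMod p))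
    (hB : B.card = t) (hpt : 4 ^ t < p) :
    ∃ m : ZMod p, m ≠ 0 ∧ ∀ b ∈ B, |(((m * b).valMinAbs : ℤ) : ℝ)| < (p : ℝ) / 4 := by
  have hp : 0 < p := (Fact.out : p.Prime).pos
  let quarter : ZMod p → (B → Fin 4) := fun x b =>
    ⟨4 * (x * (b : ZMod p)).val / p, Nat.div_lt_of_lt_mul (by
      have := ZMod.val_lt (x * (b : ZMod p))
      lia)⟩
  have hcard : Fintype.card (B → Fin 4) < Fintype.card (ZMod p) := by
    simpa [hB, ZMod.card] using hpt
  obtain ⟨x, y, hxy, hq⟩ := Fintype.exists_ne_map_eq_of_card_lt quarter hcard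
  refine ⟨x - y, sub_ne_zero.mpr hxy, fun b hb => ?_⟩
  have hdiv : 4 * (x * b).val / p = 4 * (y * b).val / p :=
    congrArg Fin.val (congrFun hq ⟨b, hb⟩)
  have h := four_mul_abs_valMinAbs_sub_lt hdiv
  rw [← sub_mul] at h
  have hR : (4 : ℝ) * |(((x - y) * b).valMinAbs : ℝ)| < p := by exact_mod_cast h
  linarith
end

section
/- Let p be a (sufficiently large) prime, let t ≥ 3 be an integer, and let A ⊆ Z/pZ be a nonempty set with |A| < (log p)^{t−1} (5t log log p)^{−2t+2}. Then there exist an integer m with 1 ≤ m ≤ t − 1 and elements d_1, ..., d_m ∈ Z/pZ such that there is exactly one b ∈ Z/pZ satisfying b ∈ A and b + d_i ∈ A for all i = 1, ..., m. -/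
open Finset in
/-- Greedy hitting set: if every `F i` has density at least `δ` in `C`, then some `k` elements of
`C` meet all but a `(1 - δ) ^ k` proportion of the sets `F i`. -/
theorem exists_card_le_disjoint_le {ι α : Type*} [DecidableEq α] (I : Finset ι) {C : Finset α}
    (hC : C.Nonempty) (F : ι → Finset α) (hF : ∀ i ∈ I, F i ⊆ C) {δ : ℝ} (hδ : δ ≤ 1)
    (h : ∀ i ∈ I, δ * #C ≤ #(F i)) (k : ℕ) :
    ∃ E ⊆ C, #E ≤ k ∧ (#{i ∈ I | Disjoint (F i) E} : ℝ) ≤ (1 - δ) ^ k * #I := by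
  classical
  induction k with
  | zero => exact ⟨∅, by simp, by simp, by simp⟩
  | succ k ih =>
    obtain ⟨E, hEC, hEk, hE⟩ := ih
    set J := {i ∈ I | Disjoint (F i) E} with hJ
    obtain ⟨e, heC, he⟩ : ∃ e ∈ C, δ * #J ≤ #{i ∈ J | e ∈ F i} := by
      refine exists_le_of_sum_le hC ?_
      have hcount : ∑ e ∈ C, #{i ∈ J | e ∈ F i} = ∑ i ∈ J, #{e ∈ C | e ∈ F i} :=
        sum_card_bipartiteAbove_eq_sum_card_bipartiteBelow (fun e i => e ∈ F i)
      have hsum : ∑ i ∈ J, δ * (#C : ℝ) ≤ ∑ i ∈ J, (#{e ∈ C | e ∈ F i} : ℝ) := by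
        refine sum_le_sum fun i hi => ?_
        have hi' := (mem_filter.1 hi).1
        rw [filter_mem_eq_inter, inter_eq_right.2 (hF i hi')]
        exact h i hi'
      rw [← Nat.cast_sum, hcount, Nat.cast_sum]
      simp only [sum_const, nsmul_eq_mul] at hsum ⊢
      linarith
    refine ⟨insert e E, insert_subset heC hEC, (card_insert_le _ _).trans (by lia), ?_⟩
    have hsub : {i ∈ I | Disjoint (F i) (insert e E)} ⊆ {i ∈ J | ¬ e ∈ F i} := by
      intro i hi
      simp only [hJ, mem_filter, disjoint_insert_right] at hi ⊢
      tauto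
    have hle : (#{i ∈ I | Disjoint (F i) (insert e E)} : ℝ) ≤ #{i ∈ J | ¬ e ∈ F i} :=
      mod_cast card_le_card hsub
    have hadd : (#{i ∈ J | e ∈ F i} : ℝ) + #{i ∈ J | ¬ e ∈ F i} = #J :=
      mod_cast card_filter_add_card_filter_not (s := J) (fun i => e ∈ F i)
    calc (#{i ∈ I | Disjoint (F i) (insert e E)} : ℝ) ≤ (1 - δ) * #J := by linarith
      _ ≤ (1 - δ) * ((1 - δ) ^ k * #I) := by gcongr
      _ = (1 - δ) ^ (k + 1) * #I := by ring

open Finset in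
/-- A nonempty set of residues has an element followed by a gap of at least average length. -/
theorem ZMod.exists_mem_forall_add_notMem {p : ℕ} [NeZero p] {B : Finset (ZMod p)}
    (hB : B.Nonempty) : ∃ s ∈ B, ∀ x : ℕ, 0 < x → x * #B < p → s + (x : ZMod p) ∉ B := by
  by_contra! hcon
  choose! f hf0 hfp hfB using hcon
  have hp := NeZero.pos p
  set L := (p - 1) / #B
  have hL : L * #B < p := by
    have := Nat.div_mul_le_self (p - 1) #B
    lia
  have hcard : #((B ×ˢ range L).image fun q => q.1 + (q.2 : ZMod p)) <
      #(univ : Finset (ZMod p)) := by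
    refine card_image_le.trans_lt ?_
    rw [card_product, card_range, card_univ, ZMod.card, mul_comm]
    exact hL
  obtain ⟨y, -, hy⟩ := exists_mem_notMem_of_card_lt_card hcard
  have hfar : ∀ s ∈ B, L ≤ (y - s).val := by
    intro s hs
    by_contra! hlt
    refine hy (mem_image.2 ⟨(s, (y - s).val), by simp [hs, hlt], ?_⟩)
    simp
  obtain ⟨s, hs, hmin⟩ := exists_min_image B (fun s => (y - s).val) hB
  have hfL : f s ≤ L := by
    rw [Nat.le_div_iff_mul_le hB.card_pos]
    have := hfp s hs
    lia
  have hnear := hmin _ (hfB s hs)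
  have hval : ((f s : ZMod p)).val = f s := by
    refine ZMod.val_cast_of_lt ?_
    have h1 := hfp s hs
    have h2 := hB.card_pos
    nlinarith
  rw [← sub_sub, ZMod.val_sub (a := y - s) (by rw [hval]; exact hfL.trans (hfar s hs)), hval] at hnear
  have := hf0 s hs
  have := hfar s hs
  lia

open Finset in
/-- Simultaneous Diophantine approximation modulo `p`, by the pigeonhole principle. -/
theorem ZMod.exists_ne_zero_forall_mul_eq_intCast {p : ℕ} [NeZero p] (E : Finset (ZMod p))
    {M : ℕ} (hM : 0 < M) (hE : M ^ #E < p) :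
    ∃ r : ZMod p, r ≠ 0 ∧ ∃ u : ZMod p → ℤ, ∀ e ∈ E, (u e : ZMod p) = r * e ∧ |u e| * M < p := by
  have hp := NeZero.pos p
  let g : ZMod p → E → Fin M := fun r e =>
    ⟨(r * e).val * M / p, by
      rw [Nat.div_lt_iff_lt_mul hp, mul_comm M]
      exact Nat.mul_lt_mul_of_pos_right (ZMod.val_lt _) hM⟩
  obtain ⟨r₁, r₂, hne, heq⟩ := Fintype.exists_ne_map_eq_of_card_lt g (by
    simpa [ZMod.card] using hE)
  refine ⟨r₁ - r₂, sub_ne_zero.2 hne, fun e => (r₁ * e).val - (r₂ * e).val, fun e he => ⟨?_, ?_⟩⟩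
  · simp [sub_mul]
  · have hdiv : (r₁ * e).val * M / p = (r₂ * e).val * M / p :=
      congrArg Fin.val (congrFun heq ⟨e, he⟩)
    have h₁ := Nat.div_add_mod ((r₁ * e).val * M) p
    have h₂ := Nat.div_add_mod ((r₂ * e).val * M) p
    have h₃ := Nat.mod_lt ((r₁ * e).val * M) hp
    have h₄ := Nat.mod_lt ((r₂ * e).val * M) hp
    rw [hdiv] at h₁
    zify at h₁ h₂ h₃ h₄
    rw [← Nat.abs_cast M, ← abs_mul, abs_lt, sub_mul]
    have h₅ := Nat.zero_le ((r₁ * e).val * M % p)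
    have h₆ := Nat.zero_le ((r₂ * e).val * M % p)
    zify at h₅ h₆
    constructor <;> linarith

open Finset in
/-- A small set `E` admits `c ∈ E` and `s ∈ A` such that moving `c` to `s` sends every other
element of `E` outside `A`. -/
theorem ZMod.exists_mem_mem_forall_add_sub_notMem {p : ℕ} [Fact p.Prime] {A E : Finset (ZMod p)}
    (hA : A.Nonempty) (hE : E.Nonempty) (hcard : (2 * #A) ^ #E < p) :
    ∃ c ∈ E, ∃ s ∈ A, ∀ e ∈ E, e ≠ c → s + (e - c) ∉ A := by
  classical
  have hn := hA.card_pos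
  obtain ⟨r, hr, u, hu⟩ := ZMod.exists_ne_zero_forall_mul_eq_intCast E (M := 2 * #A) (by lia) hcard
  obtain ⟨c, hc, hmin⟩ := exists_min_image E u hE
  obtain ⟨s', hs', hgap⟩ := ZMod.exists_mem_forall_add_notMem (hA.image (r * ·))
  obtain ⟨s, hs, rfl⟩ := mem_image.1 hs'
  rw [card_image_of_injective _ (mul_right_injective₀ hr)] at hgap
  refine ⟨c, hc, s, hs, fun e he hec hmem => ?_⟩
  obtain ⟨hue, hbe⟩ := hu e he
  obtain ⟨huc, hbc⟩ := hu c hc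
  have hne : u c ≠ u e := by
    intro h
    rw [h, hue] at huc
    exact hec (mul_left_cancel₀ hr huc)
  have hlt : u c < u e := lt_of_le_of_ne (hmin e he) hne
  obtain ⟨x, hx⟩ := Int.eq_ofNat_of_zero_le (sub_nonneg.2 hlt.le)
  refine hgap x (by lia) ?_ (mem_image.2 ⟨_, hmem, ?_⟩)
  · zify
    rw [← hx]
    push_cast at hbe hbc
    have h₁ : u e * (2 * #A) ≤ |u e| * (2 * #A) := by gcongr; exact le_abs_self _
    have h₂ : -u c * (2 * #A) ≤ |u c| * (2 * #A) := by gcongr; exact neg_le_abs _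
    nlinarith
  · have : ((x : ℤ) : ZMod p) = r * e - r * c := by rw [← hx, Int.cast_sub, hue, huc]
    rw [Int.cast_natCast] at this
    rw [this]
    ring

open Finset in
/-- Some translate of `C` by a difference of `A` and `C` meets `A` in few elements apart from the
base point. -/
theorem ZMod.exists_mem_mem_card_mul_le {p : ℕ} [Fact p.Prime] {A C : Finset (ZMod p)}
    (hA : A.Nonempty) (hC : C.Nonempty) (hCA : #C ≤ #A) {d : ℝ} (hd : 1 ≤ d) {k : ℕ}
    (hk : (1 - 1 / (2 * d)) ^ k * (#A : ℝ) ^ 2 < 1) (hkp : (2 * #A) ^ k < p) :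
    ∃ c ∈ C, ∃ s ∈ A, (#{e ∈ C | e ≠ c ∧ s + (e - c) ∈ A} : ℝ) * d ≤ #C - 1 := by
  classical
  by_contra! hcon
  have hC1 : (1 : ℝ) ≤ #C := mod_cast hC.card_pos
  have hd0 : 0 < d := by linarith
  let F : ZMod p × ZMod p → Finset (ZMod p) := fun q => {e ∈ C | e ≠ q.1 ∧ q.2 + (e - q.1) ∈ A}
  have hC2 : (2 : ℝ) ≤ #C := by
    obtain ⟨c, hc⟩ := hC
    obtain ⟨s, hs⟩ := hA
    have h1 := hcon c hc s hs
    have h2 : (0 : ℝ) < #{e ∈ C | e ≠ c ∧ s + (e - c) ∈ A} := by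
      by_contra! h0
      nlinarith
    obtain ⟨e, he⟩ := card_pos.1 (Nat.cast_pos.1 h2)
    obtain ⟨heC, hec, -⟩ := mem_filter.1 he
    exact_mod_cast one_lt_card.2 ⟨e, heC, c, hc, hec⟩
  have hδ : 1 / (2 * d) ≤ 1 := by
    rw [div_le_one (by positivity)]
    linarith
  obtain ⟨E, hEC, hEk, hE⟩ := exists_card_le_disjoint_le (C ×ˢ A) hC F
    (fun q _ => filter_subset _ _) hδ (fun q hq => by
      obtain ⟨h1, h2⟩ := mem_product.1 hq
      have := hcon q.1 h1 q.2 h2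
      change _ ≤ (#{e ∈ C | e ≠ q.1 ∧ q.2 + (e - q.1) ∈ A} : ℝ)
      rw [one_div_mul_eq_div, div_le_iff₀ (by positivity)]
      linarith) k
  have hzero : #{q ∈ C ×ˢ A | Disjoint (F q) E} = 0 := by
    rw [← Nat.lt_one_iff]
    rify
    refine hE.trans_lt (lt_of_le_of_lt ?_ hk)
    have : (0 : ℝ) ≤ 1 - 1 / (2 * d) := by linarith
    rw [card_product, sq]
    push_cast
    gcongr
  rw [card_eq_zero, filter_eq_empty_iff] at hzero
  have hEne : E.Nonempty := by
    obtain ⟨c, hc⟩ := hC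
    obtain ⟨s, hs⟩ := hA
    by_contra h
    exact hzero (mk_mem_product hc hs) (by simp [not_nonempty_iff_eq_empty.1 h])
  have hn := hA.card_pos
  obtain ⟨c, hc, s, hs, hcs⟩ := ZMod.exists_mem_mem_forall_add_sub_notMem hA hEne
    ((Nat.pow_le_pow_right (by lia) hEk).trans_lt hkp)
  obtain ⟨e, heF, heE⟩ := not_disjoint_iff.1 (hzero (mk_mem_product (hEC hc) hs))
  obtain ⟨-, hec, heA⟩ := mem_filter.1 heF
  exact hcs e heE hec heA

open Finset in
/-- Iterating: some `j + 1` elements of `A` have few common translates inside `A`. -/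
theorem ZMod.exists_forall_mem_card_translates_le {p : ℕ} [Fact p.Prime] {A : Finset (ZMod p)}
    (hA : A.Nonempty) {d : ℝ} (hd : 1 ≤ d) {k : ℕ}
    (hk : (1 - 1 / (2 * d)) ^ k * (#A : ℝ) ^ 2 < 1) (hkp : (2 * #A) ^ k < p) (j : ℕ) :
    ∃ S : Fin (j + 1) → ZMod p, (∀ i, S i ∈ A) ∧
      ((#{x : ZMod p | ∀ i, S i + x ∈ A} : ℝ) - 1) * d ^ j ≤ #A - 1 := by
  classical
  have hle : ∀ {j : ℕ} (S : Fin (j + 1) → ZMod p), #{x : ZMod p | ∀ i, S i + x ∈ A} ≤ #A :=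
    fun S => card_le_card_of_injOn (S 0 + ·) (fun x hx => (mem_filter.1 hx).2 0)
      (add_right_injective _).injOn
  induction j with
  | zero =>
    obtain ⟨a, ha⟩ := hA
    refine ⟨fun _ => a, fun _ => ha, ?_⟩
    rw [pow_zero, mul_one]
    exact sub_le_sub_right (mod_cast hle _) 1
  | succ j ih =>
    obtain ⟨S, hS, hSA⟩ := ih
    set C : Finset (ZMod p) := {x : ZMod p | ∀ i, S i + x ∈ A} with hCdef
    have hC : C.Nonempty := ⟨0, by simpa [hCdef] using hS⟩
    obtain ⟨c, hc, s, hs, hcs⟩ := ZMod.exists_mem_mem_card_mul_le hA hC (hle S) hd hk hkp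
    have hc' : ∀ i, S i + c ∈ A := by simpa [hCdef] using hc
    refine ⟨Fin.cons s fun i => S i + c, fun i => Fin.cases hs hc' i, ?_⟩
    have hcard : #{x : ZMod p | ∀ i, (Fin.cons s fun i => S i + c : Fin (j + 2) → ZMod p) i + x ∈ A}
        ≤ #{e ∈ C | e ≠ c ∧ s + (e - c) ∈ A} + 1 := by
      refine le_trans ?_ (card_insert_le c _)
      refine card_le_card_of_injOn (c + ·) (fun x hx => ?_) (add_right_injective _).injOn
      have hx' := (mem_filter.1 hx).2
      rw [Fin.forall_fin_succ] at hx'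
      simp only [Fin.cons_zero, Fin.cons_succ] at hx'
      by_cases hx0 : x = 0
      · simp [hx0]
      · simp [hCdef, hx0, hx'.1, ← add_assoc, hx'.2]
    have hcard' : (#{x : ZMod p | ∀ i,
        (Fin.cons s fun i => S i + c : Fin (j + 2) → ZMod p) i + x ∈ A} : ℝ) - 1
        ≤ #{e ∈ C | e ≠ c ∧ s + (e - c) ∈ A} := by
      rw [sub_le_iff_le_add]
      exact_mod_cast hcard
    have hd0 : 0 < d := by linarith
    calc _ ≤ (#{e ∈ C | e ≠ c ∧ s + (e - c) ∈ A} : ℝ) * d ^ (j + 1) := by gcongr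
      _ = (#{e ∈ C | e ≠ c ∧ s + (e - c) ∈ A} : ℝ) * d * d ^ j := by ring
      _ ≤ (#C - 1) * d ^ j := by gcongr
      _ ≤ _ := hSA

/-- The parameters needed in the iteration exist as soon as `log log p ≥ 2`. -/
theorem exists_pow_mul_sq_lt_one_and_pow_lt {p n t : ℕ} (hp : 0 < p) (hn : 0 < n) (ht : 1 ≤ t)
    {d : ℝ} (hd : 1 ≤ d) (hl : 2 ≤ Real.log (Real.log p))
    (hdp : d * (5 * t * Real.log (Real.log p)) ^ 2 = Real.log p) (hnd : (n : ℝ) < d ^ (t - 1)) :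
    ∃ k : ℕ, (1 - 1 / (2 * d)) ^ k * (n : ℝ) ^ 2 < 1 ∧ (2 * n) ^ k < p := by
  set l := Real.log (Real.log p)
  have hd0 : 0 < d := by linarith
  have hn1 : (1 : ℝ) ≤ n := mod_cast hn
  have ht1 : (1 : ℝ) ≤ t := mod_cast ht
  have hlogn : 0 ≤ Real.log n := Real.log_nonneg hn1
  have hX : (1 : ℝ) ≤ 5 * t * l := by nlinarith
  have hdL : d ≤ Real.log p := by
    rw [← hdp]
    exact le_mul_of_one_le_right hd0.le (one_le_pow₀ hX)
  have hlogd : Real.log d ≤ l := Real.log_le_log hd0 hdL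
  have hlogn' : Real.log n ≤ (t - 1) * l := by
    calc Real.log n ≤ Real.log (d ^ (t - 1)) := Real.log_le_log (by linarith) hnd.le
      _ = (t - 1) * Real.log d := by rw [Real.log_pow, Nat.cast_sub ht, Nat.cast_one]
      _ ≤ (t - 1) * l := by gcongr
  set k := ⌊4 * d * Real.log n⌋₊ + 1 with hkdef
  have hk1 : 4 * d * Real.log n < k := by
    rw [hkdef]
    exact_mod_cast Nat.lt_floor_add_one _
  have hk2 : (k : ℝ) ≤ 4 * d * Real.log n + 1 := by
    rw [hkdef]
    push_cast
    gcongr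
    exact Nat.floor_le (by positivity)
  refine ⟨k, ?_, ?_⟩
  · have hx : 1 / (2 * d) ≤ 1 := by
      rw [div_le_one (by positivity)]
      linarith
    have h1 : (1 - 1 / (2 * d)) ^ k ≤ Real.exp (-(k / (2 * d))) := by
      calc (1 - 1 / (2 * d)) ^ k ≤ Real.exp (-(1 / (2 * d))) ^ k := by
            exact pow_le_pow_left₀ (by linarith) (Real.one_sub_le_exp_neg _) k
        _ = Real.exp (-(k / (2 * d))) := by
            rw [← Real.exp_nat_mul]
            congr 1
            ring
    have h2 : (n : ℝ) ^ 2 = Real.exp (2 * Real.log n) := by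
      rw [← Real.exp_log (show (0 : ℝ) < n by linarith), ← Real.exp_nat_mul, Real.log_exp]
      norm_num
    calc _ ≤ Real.exp (-(k / (2 * d))) * Real.exp (2 * Real.log n) := by
          rw [h2]
          gcongr
      _ < 1 := by
          rw [← Real.exp_add, Real.exp_lt_one_iff]
          have : 2 * Real.log n < k / (2 * d) := by
            rw [lt_div_iff₀ (by positivity)]
            linarith
          linarith
  · have hlog2 : Real.log 2 ≤ l := by
      have := Real.log_two_lt_d9
      linarith
    have h1 : Real.log (2 * n) ≤ t * l := by
      rw [Real.log_mul (by norm_num) (by positivity)]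
      linarith
    have h2 : (k : ℝ) ≤ 4 * d * (t * l) := by
      have : 4 * d * Real.log n ≤ 4 * d * ((t - 1) * l) := by gcongr
      nlinarith
    have hpos : 0 < d * (t * l) ^ 2 := by positivity
    rify
    rw [← Real.log_lt_log_iff (by positivity) (by exact_mod_cast hp), Real.log_pow]
    calc (k : ℝ) * Real.log (2 * n) ≤ 4 * d * (t * l) * (t * l) := by
          gcongr
          exact Real.log_nonneg (by linarith)
      _ < d * (5 * t * l) ^ 2 := by nlinarith
      _ = Real.log p := hdp

/-- For all sufficiently large primes `p`: if `t ≥ 3` and `A ⊆ ZMod p` is nonempty with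
`|A| < (log p)^(t-1) (5t log log p)^(-2t+2)`, then there exist `1 ≤ m ≤ t - 1` and
`d_1, …, d_m ∈ ZMod p` such that exactly one `b ∈ ZMod p` satisfies `b ∈ A` and
`b + d_i ∈ A` for all `i`. -/
theorem exists_unique_common_shift : ∃ N : ℕ, ∀ p : ℕ, p.Prime → N ≤ p →
    ∀ t : ℕ, 3 ≤ t → ∀ A : Finset (ZMod p), A.Nonempty →
      (A.card : ℝ) < (Real.log p) ^ (t - 1) *
        (5 * t * Real.log (Real.log p)) ^ ((-2) * (t : ℤ) + 2) →
      ∃ m : ℕ, 1 ≤ m ∧ m ≤ t - 1 ∧ ∃ d : Fin m → ZMod p,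
        ∃! b : ZMod p, b ∈ A ∧ ∀ i : Fin m, b + d i ∈ A := by
  refine ⟨⌈Real.exp (Real.exp 2)⌉₊, fun p hp hNp t ht A hA hcard => ?_⟩
  have : Fact p.Prime := ⟨hp⟩
  have hL : Real.exp 2 ≤ Real.log p :=
    (Real.le_log_iff_exp_le (mod_cast hp.pos)).2 (Nat.ceil_le.1 hNp)
  have hL0 : 0 < Real.log p := (Real.exp_pos 2).trans_le hL
  have hl : 2 ≤ Real.log (Real.log p) := (Real.le_log_iff_exp_le hL0).2 hL
  set X : ℝ := 5 * t * Real.log (Real.log p) with hXdef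
  have hX : 0 < X := by positivity
  set d : ℝ := Real.log p / X ^ 2 with hddef
  have hnd : (A.card : ℝ) < d ^ (t - 1) := by
    have hexp : (-2) * (t : ℤ) + 2 = -((2 * (t - 1) : ℕ) : ℤ) := by
      push_cast [Nat.cast_sub (show 1 ≤ t by lia)]
      ring
    rwa [hexp, zpow_neg, zpow_natCast, pow_mul, ← div_eq_mul_inv, ← div_pow] at hcard
  have hn1 : (1 : ℝ) ≤ A.card := mod_cast hA.card_pos
  have hd0 : 0 < d := by positivity
  have hd : 1 ≤ d := by
    by_contra! h
    linarith [pow_le_one₀ hd0.le h.le (n := t - 1)]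
  obtain ⟨k, hk, hkp⟩ := exists_pow_mul_sq_lt_one_and_pow_lt hp.pos hA.card_pos (by lia) hd hl
    (div_mul_cancel₀ _ (by positivity)) hnd
  obtain ⟨S, hS, hSA⟩ := ZMod.exists_forall_mem_card_translates_le hA hd hk hkp (t - 1)
  refine ⟨t - 1, by lia, le_rfl, fun i => S i.succ - S 0, S 0, ⟨hS 0, fun i => ?_⟩, ?_⟩
  · simpa using hS i.succ
  · rintro b ⟨hb, hbd⟩
    have hone : Finset.card {x : ZMod p | ∀ i, S i + x ∈ A} ≤ 1 := by
      by_contra! h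
      have h2 : (2 : ℝ) ≤ Finset.card {x : ZMod p | ∀ i, S i + x ∈ A} := mod_cast h
      have : 0 < d ^ (t - 1) := by positivity
      nlinarith
    refine sub_eq_zero.1 (Finset.card_le_one.1 hone (b - S 0) ?_ 0 ?_)
    · rw [Finset.mem_filter]
      refine ⟨Finset.mem_univ _, fun i => Fin.cases (by simpa using hb) (fun i => ?_) i⟩
      convert hbd i using 1
      ring
    · simpa using hS
end
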